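/- Let K'_1, …, K'_t be convex subsets of ℝ^n with ⋂_{i=1}^t K'_i ≠ ∅, and suppose the sets K_i := K'_i ∩ ℤ^n (i = 1, …, t) form a critical family, i.e., ⋂_{i=1}^t K_i = ∅ and ⋂_{j ≠ k} K_j ≠ ∅ for every k. Let L'_1, …, L'_s be convex subsets of ℝ^n such that ℤ^n ⊆ ⋃_{i=1}^s L'_i and L'_i ∩ K'_1 ∩ … ∩ K'_t = ∅ for every i ∈ {1, …, s}. Then t ≤ s · n; equivalently, s ≥ t/n. -/

import Mathlib

/-- If convex sets `K j` in `ℝⁿ` have a common point, but none inside the convex set `L`, then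
already at most `n` of the `K j` have no common point inside `L`. -/
theorem exists_card_le_forall_notMem_of_convex {n : ℕ} {ι : Type*} [Fintype ι]
    {K : ι → Set (Fin n → ℝ)} (hK : ∀ i, Convex ℝ (K i)) (hne : (⋂ i, K i).Nonempty)
    {L : Set (Fin n → ℝ)} (hL : Convex ℝ L) (hempty : L ∩ ⋂ i, K i = ∅) :
    ∃ S : Finset ι, S.card ≤ n ∧ ∀ x ∈ L, ¬ ∀ j ∈ S, x ∈ K j := by
  classical
  by_contra! hS
  have hF : (⋂ o ∈ (Finset.univ : Finset (Option ι)), o.elim L K).Nonempty := by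
    refine Convex.helly_theorem' (𝕜 := ℝ) ?_ ?_
    · rintro (_ | i) -
      exacts [hL, hK i]
    · intro I _ hI
      rw [Module.finrank_fin_fun] at hI
      by_cases hnone : none ∈ I
      · have hcard : I.eraseNone.card ≤ n := by
          rw [Finset.card_eraseNone_eq_card_erase, Finset.card_erase_of_mem hnone]
          omega
        obtain ⟨x, hxL, hx⟩ := hS _ hcard
        refine ⟨x, Set.mem_iInter₂.2 ?_⟩
        rintro (_ | i) hi
        exacts [hxL, hx i (Finset.mem_eraseNone.2 hi)]
      · obtain ⟨x, hx⟩ := hne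
        refine ⟨x, Set.mem_iInter₂.2 ?_⟩
        rintro (_ | i) hi
        exacts [absurd hi hnone, Set.mem_iInter.1 hx i]
  obtain ⟨x, hx⟩ := hF
  rw [Set.mem_iInter₂] at hx
  have : x ∈ L ∩ ⋂ i, K i :=
    ⟨hx none (Finset.mem_univ _), Set.mem_iInter.2 fun i ↦ hx (some i) (Finset.mem_univ _)⟩
  rwa [hempty] at this

theorem stmt1 (n t s : ℕ)
    (K' : Fin t → Set (Fin n → ℝ)) (hK'conv : ∀ i, Convex ℝ (K' i))
    (hK'ne : (⋂ i, K' i) ≠ ∅)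
    (hcrit1 : (⋂ i, K' i ∩ {x : Fin n → ℝ | ∀ j, ∃ m : ℤ, x j = (m : ℝ)}) = ∅)
    (hcrit2 : ∀ k : Fin t,
      (⋂ j ∈ Finset.univ.erase k,
        K' j ∩ {x : Fin n → ℝ | ∀ j', ∃ m : ℤ, x j' = (m : ℝ)}) ≠ ∅)
    (L' : Fin s → Set (Fin n → ℝ)) (hL'conv : ∀ i, Convex ℝ (L' i))
    (hcover : {x : Fin n → ℝ | ∀ j, ∃ m : ℤ, x j = (m : ℝ)} ⊆ ⋃ i, L' i)
    (hempty : ∀ i, (L' i ∩ ⋂ j, K' j) = ∅) :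
    t ≤ s * n := by
  choose S hScard hS using fun i ↦ exists_card_le_forall_notMem_of_convex hK'conv
    (Set.nonempty_iff_ne_empty.2 hK'ne) (hL'conv i) (hempty i)
  by_contra! hlt
  have hcard : (Finset.univ.biUnion S).card < (Finset.univ : Finset (Fin t)).card := by
    refine lt_of_le_of_lt (Finset.card_biUnion_le_card_mul _ _ n fun i _ ↦ hScard i) ?_
    simpa using hlt
  obtain ⟨k, -, hk⟩ := Finset.exists_mem_notMem_of_card_lt_card hcard
  obtain ⟨x, hxint, hxK⟩ : ∃ x : Fin n → ℝ, (∀ j, ∃ m : ℤ, x j = (m : ℝ)) ∧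
      ∀ j ≠ k, x ∈ K' j := by
    by_cases hj : ∃ j, j ≠ k
    · obtain ⟨j, hj⟩ := hj
      obtain ⟨x, hx⟩ := Set.nonempty_iff_ne_empty.2 (hcrit2 k)
      rw [Set.mem_iInter₂] at hx
      exact ⟨x, (hx j (by simp [hj])).2, fun i hi ↦ (hx i (by simp [hi])).1⟩
    · push Not at hj
      exact ⟨0, fun _ ↦ ⟨0, by simp⟩, fun j hjk ↦ absurd (hj j) hjk⟩
  obtain ⟨i, hi⟩ := Set.mem_iUnion.1 (hcover hxint)
  refine hS i x hi fun j hj ↦ hxK j ?_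
  rintro rfl
  exact hk (Finset.mem_biUnion.2 ⟨i, Finset.mem_univ _, hj⟩)
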